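/- arXiv:2407.09321 — 5 statements merged into one kernel-verified Lean document; each statement's English description precedes it below -/
import Mathlib

section
/- Let β ∈ (−1, 1), μ₊, μ₋ ∈ ℝ, q > 0, x ≥ 0 and y > 0. Define p(t; x, y) := φ_t(y − x; μ₊) − e^{−2 μ₊ x} φ_t(x + y; μ₊) + 2(1+β) e^{2 μ₊ y} ∫₀^∞ ∫₀^t h(t − τ; (1+β) b + x + y, μ₊) · h(τ; (1−β) b, −μ₋) dτ db. Then ∫₀^∞ e^{−q t} p(t; x, y) dt = (e^{μ₊ (y − x)}/√(μ₊² + 2q)) · ( e^{−|y − x| √(μ₊² + 2q)} − e^{−(x + y) √(μ₊² + 2q)} ) + (2(1+β)/D(q)) · e^{μ₊ (y − x) − (x + y) √(μ₊² + 2q)}. -/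
open MeasureTheory Real Set Filter

/-- The auxiliary density `h(t; x, μ) = |x| / √(2π t³) · exp(−(x + μ t)² / (2t))`. -/
noncomputable def h (t x μ : ℝ) : ℝ :=
  |x| / Real.sqrt (2 * Real.pi * t ^ 3) * Real.exp (-(x + μ * t) ^ 2 / (2 * t))

/-- Gaussian density with drift: `φ_t(z; μ) = (1/√(2π t)) exp(−(z − μ t)²/(2t))`. -/
noncomputable def phi (t z μ : ℝ) : ℝ :=
  1 / Real.sqrt (2 * Real.pi * t) * Real.exp (-(z - μ * t) ^ 2 / (2 * t))

/-- `D(q) = (1+β)(μ₊ + √(2q+μ₊²)) + (1−β)(−μ₋ + √(2q+μ₋²))`. -/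
noncomputable def D (β μp μm q : ℝ) : ℝ :=
  (1 + β) * (μp + Real.sqrt (2 * q + μp ^ 2)) + (1 - β) * (-μm + Real.sqrt (2 * q + μm ^ 2))

/-- Unnormalised Gaussian primitive. -/
noncomputable def gaussPrimitive (u : ℝ) : ℝ :=
  ∫ v in (0 : ℝ)..u, Real.exp (-(1 / 2) * v ^ 2)

lemma hasDerivAt_gaussPrimitive (u : ℝ) :
    HasDerivAt gaussPrimitive (Real.exp (-(1 / 2) * u ^ 2)) u := by
  have hc : Continuous fun v : ℝ => Real.exp (-(1 / 2) * v ^ 2) := by fun_prop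
  exact hc.integral_hasStrictDerivAt 0 u |>.hasDerivAt

lemma gaussPrimitive_neg (u : ℝ) : gaussPrimitive (-u) = -gaussPrimitive u := by
  have := intervalIntegral.integral_comp_neg (a := 0) (b := u)
    (fun v : ℝ => Real.exp (-(1 / 2) * v ^ 2))
  simp only [neg_sq, neg_zero] at this
  rw [gaussPrimitive, gaussPrimitive, this, intervalIntegral.integral_symm]

lemma tendsto_gaussPrimitive_atTop :
    Tendsto gaussPrimitive atTop (nhds (√(2 * π) / 2)) := by
  have h1 := intervalIntegral_tendsto_integral_Ioi (0 : ℝ)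
    (integrable_exp_neg_mul_sq (b := 1 / 2) (by norm_num)).integrableOn tendsto_id
  rw [integral_gaussian_Ioi] at h1
  convert! h1 using 4
  ring

lemma tendsto_gaussPrimitive_atBot :
    Tendsto gaussPrimitive atBot (nhds (-(√(2 * π) / 2))) := by
  have := (tendsto_gaussPrimitive_atTop.comp tendsto_neg_atBot_atTop).neg
  refine this.congr fun u => ?_
  simp [gaussPrimitive_neg]

lemma hasDerivAt_linear_div_sqrt (s z : ℝ) {t : ℝ} (ht : 0 < t) :
    HasDerivAt (fun t => (s * t + z) / √t) (s / (2 * √t) - z / (2 * t * √t)) t := by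
  have h1 : HasDerivAt (fun t : ℝ => s * t + z) s t := by
    simpa using ((hasDerivAt_id t).const_mul s).add_const z
  have h0 : 0 < √t := Real.sqrt_pos.2 ht
  refine (h1.div (Real.hasDerivAt_sqrt ht.ne') h0.ne').congr_deriv ?_
  obtain ⟨r, hr⟩ : ∃ r, r = √t := ⟨_, rfl⟩
  have h2 : t = r ^ 2 := by rw [hr, Real.sq_sqrt ht.le]
  rw [← hr] at h0 ⊢
  subst h2
  field_simp
  ring

lemma tendsto_linear_div_sqrt_atTop {s : ℝ} (hs : 0 < s) (z : ℝ) :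
    Tendsto (fun t => (s * t + z) / √t) atTop atTop := by
  have h1 : Tendsto (fun t : ℝ => s * √t) atTop atTop :=
    Real.tendsto_sqrt_atTop.const_mul_atTop hs
  have h2 : Tendsto (fun t : ℝ => z / √t) atTop (nhds 0) :=
    Real.tendsto_sqrt_atTop.const_div_atTop z
  refine (h1.atTop_add h2).congr' ?_
  filter_upwards [eventually_gt_atTop 0] with t ht
  rw [add_div, mul_div_assoc, Real.div_sqrt]

lemma tendsto_inv_sqrt_nhdsGT : Tendsto (fun t : ℝ => (√t)⁻¹) (nhdsWithin 0 (Ioi 0)) atTop := by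
  refine tendsto_inv_nhdsGT_zero.comp (tendsto_nhdsWithin_iff.2 ⟨?_, ?_⟩)
  · have : Tendsto (fun t : ℝ => √t) (nhds 0) (nhds (√0)) := Real.continuous_sqrt.tendsto 0
    rw [Real.sqrt_zero] at this
    exact this.mono_left nhdsWithin_le_nhds
  · filter_upwards [self_mem_nhdsWithin] with t ht using Real.sqrt_pos.2 ht

lemma tendsto_linear_nhdsGT (s z : ℝ) :
    Tendsto (fun t : ℝ => s * t + z) (nhdsWithin 0 (Ioi 0)) (nhds z) := by
  have : Tendsto (fun t : ℝ => s * t + z) (nhds 0) (nhds (s * 0 + z)) :=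
    Continuous.tendsto (by fun_prop) 0
  rw [mul_zero, zero_add] at this
  exact this.mono_left nhdsWithin_le_nhds

lemma tendsto_linear_div_sqrt_zero_pos (s : ℝ) {z : ℝ} (hz : 0 < z) :
    Tendsto (fun t => (s * t + z) / √t) (nhdsWithin 0 (Ioi 0)) atTop := by
  simp only [div_eq_mul_inv]
  exact (tendsto_linear_nhdsGT s z).pos_mul_atTop hz tendsto_inv_sqrt_nhdsGT

lemma tendsto_linear_div_sqrt_zero_neg (s : ℝ) {z : ℝ} (hz : z < 0) :
    Tendsto (fun t => (s * t + z) / √t) (nhdsWithin 0 (Ioi 0)) atBot := by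
  simp only [div_eq_mul_inv]
  exact (tendsto_linear_nhdsGT s z).neg_mul_atTop hz tendsto_inv_sqrt_nhdsGT

lemma tendsto_linear_div_sqrt_zero_zero (s : ℝ) :
    Tendsto (fun t => (s * t + 0) / √t) (nhdsWithin 0 (Ioi 0)) (nhds 0) := by
  have : Tendsto (fun t : ℝ => s * √t) (nhds 0) (nhds (s * √0)) :=
    Continuous.tendsto (by fun_prop) 0
  rw [Real.sqrt_zero, mul_zero] at this
  refine (this.mono_left nhdsWithin_le_nhds).congr' ?_
  filter_upwards [self_mem_nhdsWithin] with t ht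
  rw [add_zero, mul_div_assoc, Real.div_sqrt]

/-- Improper integration of a nonnegative derivative, with a one-sided limit at the left end. -/
lemma integral_Ioi_of_hasDerivAt_of_nonneg_of_tendsto {f f' : ℝ → ℝ} {a l m : ℝ}
    (hderiv : ∀ t ∈ Ioi a, HasDerivAt f (f' t) t) (hpos : ∀ t ∈ Ioi a, 0 ≤ f' t)
    (hl : Tendsto f (nhdsWithin a (Ioi a)) (nhds l)) (hm : Tendsto f atTop (nhds m)) :
    IntegrableOn f' (Ioi a) ∧ ∫ t in Ioi a, f' t = m - l := by
  have hc : ContinuousWithinAt (Function.update f a l) (Ici a) a := by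
    rw [continuousWithinAt_update_same]
    simpa using hl
  have hd : ∀ t ∈ Ioi a, HasDerivAt (Function.update f a l) (f' t) t := fun t ht =>
    (hderiv t ht).congr_of_eventuallyEq <| by
      filter_upwards [isOpen_Ioi.mem_nhds ht] with r hr
      exact Function.update_of_ne (ne_of_gt hr) _ _
  have hm' : Tendsto (Function.update f a l) atTop (nhds m) := hm.congr' <| by
    filter_upwards [eventually_gt_atTop a] with r hr
    exact (Function.update_of_ne (ne_of_gt hr) _ _).symm
  refine ⟨integrableOn_Ioi_deriv_of_nonneg hc hd hpos hm', ?_⟩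
  rw [integral_Ioi_of_hasDerivAt_of_nonneg hc hd hpos hm', Function.update_self]

lemma exp_mul_gauss_reflect (s z : ℝ) {t : ℝ} (ht : 0 < t) :
    Real.exp (2 * z * s) * Real.exp (-(1 / 2) * ((s * t + z) / √t) ^ 2)
      = Real.exp (-(1 / 2) * ((s * t + -z) / √t) ^ 2) := by
  rw [← Real.exp_add, div_pow, div_pow, Real.sq_sqrt ht.le]
  congr 1
  field_simp
  ring

/-- The inverse Gaussian density has total mass one. -/
lemma integral_inverseGaussian {s z : ℝ} (hs : 0 < s) (hz : 0 < z) :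
    IntegrableOn (fun t => Real.exp (-(1 / 2) * ((s * t + -z) / √t) ^ 2) * (z / (t * √t))) (Ioi 0) ∧
    ∫ t in Ioi (0 : ℝ), Real.exp (-(1 / 2) * ((s * t + -z) / √t) ^ 2) * (z / (t * √t))
      = √(2 * π) := by
  have key := integral_Ioi_of_hasDerivAt_of_nonneg_of_tendsto (a := 0)
    (f := fun t => gaussPrimitive ((s * t + -z) / √t)
      - Real.exp (2 * z * s) * gaussPrimitive ((s * t + z) / √t))
    (f' := fun t => Real.exp (-(1 / 2) * ((s * t + -z) / √t) ^ 2) * (z / (t * √t)))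
    (fun t (ht : 0 < t) => by
      refine (((hasDerivAt_gaussPrimitive _).comp t (hasDerivAt_linear_div_sqrt s (-z) ht)).sub
        (((hasDerivAt_gaussPrimitive _).comp t
          (hasDerivAt_linear_div_sqrt s z ht)).const_mul _)).congr_deriv ?_
      rw [← mul_assoc, exp_mul_gauss_reflect s z ht]
      have := Real.sqrt_pos.2 ht
      field_simp
      ring)
    (fun t (ht : 0 < t) => by positivity)
    ((tendsto_gaussPrimitive_atBot.comp
      (tendsto_linear_div_sqrt_zero_neg s (neg_neg_of_pos hz))).sub
      ((tendsto_gaussPrimitive_atTop.comp (tendsto_linear_div_sqrt_zero_pos s hz)).const_mul _))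
    ((tendsto_gaussPrimitive_atTop.comp (tendsto_linear_div_sqrt_atTop hs (-z))).sub
      ((tendsto_gaussPrimitive_atTop.comp (tendsto_linear_div_sqrt_atTop hs z)).const_mul _))
  refine ⟨key.1, key.2.trans ?_⟩
  ring

lemma integral_gaussian_time {s z : ℝ} (hs : 0 < s) (hz : 0 ≤ z) :
    IntegrableOn (fun t => Real.exp (-(1 / 2) * ((s * t + -z) / √t) ^ 2) * (s / √t)) (Ioi 0) ∧
    ∫ t in Ioi (0 : ℝ), Real.exp (-(1 / 2) * ((s * t + -z) / √t) ^ 2) * (s / √t)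
      = √(2 * π) := by
  have hl : Tendsto (fun t => gaussPrimitive ((s * t + -z) / √t)
      + Real.exp (2 * z * s) * gaussPrimitive ((s * t + z) / √t)) (nhdsWithin 0 (Ioi 0))
      (nhds (-(√(2 * π) / 2) + Real.exp (2 * z * s) * (√(2 * π) / 2))) := by
    rcases hz.eq_or_lt with rfl | hz
    · have h0 : Tendsto gaussPrimitive (nhds 0) (nhds 0) := by
        have := (hasDerivAt_gaussPrimitive 0).continuousAt.tendsto
        rwa [gaussPrimitive, intervalIntegral.integral_same] at this
      have h1 := h0.comp (tendsto_linear_div_sqrt_zero_zero s)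
      have h2 := h1.add (h1.const_mul (Real.exp (2 * 0 * s)))
      have hlim : (0 : ℝ) + Real.exp (2 * 0 * s) * 0
          = -(√(2 * π) / 2) + Real.exp (2 * 0 * s) * (√(2 * π) / 2) := by simp
      rw [hlim] at h2
      refine h2.congr fun t => ?_
      simp
    · exact (tendsto_gaussPrimitive_atBot.comp
        (tendsto_linear_div_sqrt_zero_neg s (neg_neg_of_pos hz))).add
        ((tendsto_gaussPrimitive_atTop.comp (tendsto_linear_div_sqrt_zero_pos s hz)).const_mul _)
  have key := integral_Ioi_of_hasDerivAt_of_nonneg_of_tendsto (a := 0)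
    (f' := fun t => Real.exp (-(1 / 2) * ((s * t + -z) / √t) ^ 2) * (s / √t))
    (fun t (ht : 0 < t) => by
      refine (((hasDerivAt_gaussPrimitive _).comp t (hasDerivAt_linear_div_sqrt s (-z) ht)).add
        (((hasDerivAt_gaussPrimitive _).comp t
          (hasDerivAt_linear_div_sqrt s z ht)).const_mul _)).congr_deriv ?_
      rw [← mul_assoc, exp_mul_gauss_reflect s z ht]
      have := Real.sqrt_pos.2 ht
      field_simp
      ring)
    (fun t (ht : 0 < t) => by positivity)
    hl
    ((tendsto_gaussPrimitive_atTop.comp (tendsto_linear_div_sqrt_atTop hs (-z))).add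
      ((tendsto_gaussPrimitive_atTop.comp (tendsto_linear_div_sqrt_atTop hs z)).const_mul _))
  refine ⟨key.1, key.2.trans ?_⟩
  ring

lemma sqrt_drift_pos (μ : ℝ) {q : ℝ} (hq : 0 < q) : 0 < √(2 * q + μ ^ 2) :=
  Real.sqrt_pos.2 (by positivity)

/-- Laplace transform in time of the first-passage density. -/
lemma laplace_h {q x : ℝ} (hq : 0 < q) (hx : 0 < x) (μ : ℝ) :
    IntegrableOn (fun t => Real.exp (-q * t) * h t x μ) (Ioi 0) ∧
    ∫ t in Ioi (0 : ℝ), Real.exp (-q * t) * h t x μ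
      = Real.exp (-(x * (μ + √(2 * q + μ ^ 2)))) := by
  obtain ⟨hi, hv⟩ := integral_inverseGaussian (sqrt_drift_pos μ hq) hx
  have hs2 := Real.sq_sqrt (show 0 ≤ 2 * q + μ ^ 2 by positivity)
  set s := √(2 * q + μ ^ 2)
  have hc : EqOn (fun t => Real.exp (-q * t) * h t x μ)
      (fun t => Real.exp (-(x * (μ + s))) / √(2 * π) *
        (Real.exp (-(1 / 2) * ((s * t + -x) / √t) ^ 2) * (x / (t * √t)))) (Ioi 0) := by
    intro t (ht : 0 < t)
    have e1 : √(2 * π * t ^ 3) = √(2 * π) * (t * √t) := by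
      rw [Real.sqrt_mul (by positivity) (t ^ 3), show t ^ 3 = t ^ 2 * t by ring,
        Real.sqrt_mul (sq_nonneg t) t, Real.sqrt_sq ht.le]
    have e2 : Real.exp (-q * t) * Real.exp (-(x + μ * t) ^ 2 / (2 * t))
        = Real.exp (-(x * (μ + s))) * Real.exp (-(1 / 2) * ((s * t + -x) / √t) ^ 2) := by
      rw [← Real.exp_add, ← Real.exp_add, div_pow, Real.sq_sqrt ht.le]
      congr 1
      have hq' : q = (s ^ 2 - μ ^ 2) / 2 := by linarith
      rw [hq']
      field_simp
      ring
    have := Real.sqrt_pos.2 ht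
    simp only [h]
    rw [e1, abs_of_pos hx, mul_left_comm, e2]
    field_simp
  refine ⟨(integrableOn_congr_fun hc measurableSet_Ioi).2 (hi.const_mul _), ?_⟩
  rw [setIntegral_congr_fun measurableSet_Ioi hc, integral_const_mul, hv]
  have : 0 < √(2 * π) := by positivity
  field_simp

/-- Laplace transform in time of the Gaussian density with drift. -/
lemma laplace_phi {q : ℝ} (hq : 0 < q) (z μ : ℝ) :
    IntegrableOn (fun t => Real.exp (-q * t) * phi t z μ) (Ioi 0) ∧
    ∫ t in Ioi (0 : ℝ), Real.exp (-q * t) * phi t z μ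
      = Real.exp (μ * z - |z| * √(2 * q + μ ^ 2)) / √(2 * q + μ ^ 2) := by
  obtain ⟨hi, hv⟩ := integral_gaussian_time (sqrt_drift_pos μ hq) (abs_nonneg z)
  have hs2 := Real.sq_sqrt (show 0 ≤ 2 * q + μ ^ 2 by positivity)
  have hs := sqrt_drift_pos μ hq
  set s := √(2 * q + μ ^ 2)
  have hc : EqOn (fun t => Real.exp (-q * t) * phi t z μ)
      (fun t => Real.exp (μ * z - |z| * s) / (s * √(2 * π)) *
        (Real.exp (-(1 / 2) * ((s * t + -|z|) / √t) ^ 2) * (s / √t))) (Ioi 0) := by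
    intro t (ht : 0 < t)
    have e2 : Real.exp (-q * t) * Real.exp (-(z - μ * t) ^ 2 / (2 * t))
        = Real.exp (μ * z - |z| * s) * Real.exp (-(1 / 2) * ((s * t + -|z|) / √t) ^ 2) := by
      rw [← Real.exp_add, ← Real.exp_add, div_pow, Real.sq_sqrt ht.le]
      congr 1
      have hq' : q = (s ^ 2 - μ ^ 2) / 2 := by linarith
      have hz : (s * t + -|z|) ^ 2 = s ^ 2 * t ^ 2 - 2 * s * t * |z| + z ^ 2 := by
        rw [← sq_abs z]; ring
      rw [hq', hz]
      field_simp
      ring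
    have := Real.sqrt_pos.2 ht
    simp only [phi]
    rw [Real.sqrt_mul (by positivity), mul_left_comm, e2]
    field_simp
  refine ⟨(integrableOn_congr_fun hc measurableSet_Ioi).2 (hi.const_mul _), ?_⟩
  rw [setIntegral_congr_fun measurableSet_Ioi hc, integral_const_mul, hv]
  have : 0 < √(2 * π) := by positivity
  field_simp

/-- Tonelli for a nonnegative family of forward convolutions. -/
lemma integral_integral_posConvolution {f g : ℝ → ℝ → ℝ} {F : ℝ → ℝ}
    (hfm : Measurable (Function.uncurry f)) (hgm : Measurable (Function.uncurry g))
    (hf0 : ∀ b t, 0 ≤ f b t) (hg0 : ∀ b t, 0 ≤ g b t)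
    (hfi : ∀ b ∈ Ioi (0 : ℝ), IntegrableOn (f b) (Ioi 0))
    (hgi : ∀ b ∈ Ioi (0 : ℝ), IntegrableOn (g b) (Ioi 0))
    (hF : ∀ b ∈ Ioi (0 : ℝ), (∫ t in Ioi 0, f b t) * ∫ t in Ioi 0, g b t = F b)
    (hFi : IntegrableOn F (Ioi 0)) :
    IntegrableOn (fun t => ∫ b in Ioi (0 : ℝ), ∫ τ in (0 : ℝ)..t, f b τ * g b (t - τ)) (Ioi 0) ∧
    ∫ t in Ioi (0 : ℝ), ∫ b in Ioi (0 : ℝ), ∫ τ in (0 : ℝ)..t, f b τ * g b (t - τ)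
      = ∫ b in Ioi (0 : ℝ), F b := by
  set C : ℝ → ℝ → ℝ := fun b => posConvolution (f b) (g b) (ContinuousLinearMap.mul ℝ ℝ) with hC
  have hCt : ∀ b, ∀ t ∈ Ioi (0 : ℝ), C b t = ∫ τ in (0 : ℝ)..t, f b τ * g b (t - τ) := by
    intro b t ht
    simp only [hC, posConvolution, indicator_of_mem ht, ContinuousLinearMap.mul_apply']
  have hC0 : ∀ b t, 0 ≤ C b t := by
    intro b t
    refine indicator_nonneg (fun t (ht : 0 < t) => ?_) t
    exact intervalIntegral.integral_nonneg ht.le fun τ _ => mul_nonneg (hf0 _ _) (hg0 _ _)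
  have hCm : Measurable (Function.uncurry C) := by
    have hm : Measurable fun p : (ℝ × ℝ) × ℝ =>
        (Ioi (0 : ℝ)).indicator (f p.1.1) p.2
          * (Ioi (0 : ℝ)).indicator (g p.1.1) (p.1.2 - p.2) := by
      refine Measurable.mul ?_ ?_
      · exact Measurable.ite (measurableSet_lt measurable_const measurable_snd)
          (hfm.comp (measurable_fst.fst.prodMk measurable_snd)) measurable_const
      · exact Measurable.ite (measurableSet_lt measurable_const
          (measurable_fst.snd.sub measurable_snd))
          (hgm.comp (measurable_fst.fst.prodMk (measurable_fst.snd.sub measurable_snd)))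
          measurable_const
    convert! (hm.stronglyMeasurable.integral_prod_right' (ν := volume)).measurable using 1
    ext ⟨b, t⟩
    simp only [Function.uncurry, hC, posConvolution_eq_convolution_indicator]
    rfl
  have hint : ∀ b ∈ Ioi (0 : ℝ), ∫ t in Ioi 0, C b t = F b := fun b hb => by
    rw [setIntegral_congr_fun measurableSet_Ioi (hCt b), ← hF b hb]
    exact integral_posConvolution (hfi b hb) (hgi b hb) (ContinuousLinearMap.mul ℝ ℝ)
  have hprod : Integrable (Function.uncurry C)
      ((volume.restrict (Ioi 0)).prod (volume.restrict (Ioi 0))) := by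
    refine (integrable_prod_iff hCm.aestronglyMeasurable).2 ⟨?_, ?_⟩
    · filter_upwards [ae_restrict_mem measurableSet_Ioi] with b hb
      exact (integrable_posConvolution (hfi b hb) (hgi b hb)
        (ContinuousLinearMap.mul ℝ ℝ)).integrableOn
    · refine (integrableOn_congr_fun (fun b hb => ?_) measurableSet_Ioi).2 hFi
      simp only [Function.uncurry, Real.norm_of_nonneg (hC0 _ _)]
      exact hint b hb
  have hcongr : EqOn (fun t => ∫ b in Ioi (0 : ℝ), ∫ τ in (0 : ℝ)..t, f b τ * g b (t - τ))
      (fun t => ∫ b in Ioi (0 : ℝ), C b t) (Ioi 0) := fun t ht => by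
    simp only [hCt _ t ht]
  refine ⟨(integrableOn_congr_fun hcongr measurableSet_Ioi).2 hprod.integral_prod_right, ?_⟩
  rw [setIntegral_congr_fun measurableSet_Ioi hcongr, ← integral_integral_swap hprod]
  exact setIntegral_congr_fun measurableSet_Ioi hint

lemma h_nonneg (t x μ : ℝ) : 0 ≤ h t x μ := by
  unfold h; positivity

lemma laplace_convolution_h {q β μp μm w : ℝ} (hβ : β ∈ Ioo (-1 : ℝ) 1) (hq : 0 < q)
    (hw : 0 < w) :
    IntegrableOn (fun t => Real.exp (-q * t) * ∫ b in Ioi (0 : ℝ), ∫ τ in (0 : ℝ)..t,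
      h (t - τ) ((1 + β) * b + w) μp * h τ ((1 - β) * b) (-μm)) (Ioi 0) ∧
    ∫ t in Ioi (0 : ℝ), Real.exp (-q * t) * (∫ b in Ioi (0 : ℝ), ∫ τ in (0 : ℝ)..t,
      h (t - τ) ((1 + β) * b + w) μp * h τ ((1 - β) * b) (-μm))
      = Real.exp (-(w * (μp + √(2 * q + μp ^ 2)))) / D β μp μm q := by
  have h1 : 0 < 1 + β := by linarith [hβ.1]
  have h2 : 0 < 1 - β := by linarith [hβ.2]
  have hlt : ∀ μ : ℝ, 0 < μ + √(2 * q + μ ^ 2) := fun μ => by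
    have : √(μ ^ 2) < √(2 * q + μ ^ 2) := Real.sqrt_lt_sqrt (sq_nonneg _) (by linarith)
    rw [Real.sqrt_sq_eq_abs] at this
    linarith [neg_abs_le μ]
  have hD : 0 < D β μp μm q := by
    have e2 := hlt (-μm)
    rw [neg_sq] at e2
    exact add_pos (mul_pos h1 (hlt μp)) (mul_pos h2 e2)
  have hexp : ∀ (t : ℝ), (Real.exp (-q * t) * ∫ b in Ioi (0 : ℝ), ∫ τ in (0 : ℝ)..t,
      h (t - τ) ((1 + β) * b + w) μp * h τ ((1 - β) * b) (-μm))
      = ∫ b in Ioi (0 : ℝ), ∫ τ in (0 : ℝ)..t,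
        (Real.exp (-q * τ) * h τ ((1 - β) * b) (-μm)) *
        (Real.exp (-q * (t - τ)) * h (t - τ) ((1 + β) * b + w) μp) := fun t => by
    rw [← integral_const_mul]
    congr 1 with b
    rw [← intervalIntegral.integral_const_mul]
    congr 1 with τ
    rw [show -q * t = -q * τ + -q * (t - τ) by ring, Real.exp_add]
    ring
  have key := integral_integral_posConvolution
    (f := fun b τ => Real.exp (-q * τ) * h τ ((1 - β) * b) (-μm))
    (g := fun b τ => Real.exp (-q * τ) * h τ ((1 + β) * b + w) μp)
    (F := fun b => Real.exp (-(w * (μp + √(2 * q + μp ^ 2)))) *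
      Real.exp (-D β μp μm q * b))
    (by unfold h Function.uncurry; fun_prop) (by unfold h Function.uncurry; fun_prop)
    (fun b t => mul_nonneg (Real.exp_pos _).le (h_nonneg _ _ _))
    (fun b t => mul_nonneg (Real.exp_pos _).le (h_nonneg _ _ _))
    (fun b (hb : 0 < b) => (laplace_h hq (by positivity) _).1)
    (fun b (hb : 0 < b) => (laplace_h hq (by positivity) _).1)
    (fun b (hb : 0 < b) => by
      rw [(laplace_h hq (by positivity) _).2, (laplace_h hq (by positivity) _).2,
        ← Real.exp_add, ← Real.exp_add]
      congr 1
      simp only [D, neg_sq]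
      ring)
    ((integrableOn_exp_mul_Ioi (neg_neg_of_pos hD) 0).const_mul _)
  simp only [hexp]
  refine ⟨key.1, key.2.trans ?_⟩
  rw [integral_const_mul, integral_exp_mul_Ioi (neg_neg_of_pos hD)]
  simp
  field_simp

/-- Laplace transform in `t` of the transition density `p(t; x, y)` of refracted skew
Brownian motion for `x ≥ 0` and `y > 0`. -/
theorem laplace_p_xpos_ypos (β μp μm q x y : ℝ)
    (hβ : β ∈ Ioo (-1 : ℝ) 1) (hq : 0 < q) (hx : 0 ≤ x) (hy : 0 < y) :
    ∫ t in Ioi (0 : ℝ), Real.exp (-q * t) *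
        (phi t (y - x) μp - Real.exp (-(2 * μp * x)) * phi t (x + y) μp
          + 2 * (1 + β) * Real.exp (2 * μp * y) *
            ∫ b in Ioi (0 : ℝ), ∫ τ in (0 : ℝ)..t,
              h (t - τ) ((1 + β) * b + x + y) μp * h τ ((1 - β) * b) (-μm))
      = Real.exp (μp * (y - x)) / Real.sqrt (μp ^ 2 + 2 * q) *
            (Real.exp (-|y - x| * Real.sqrt (μp ^ 2 + 2 * q))
              - Real.exp (-(x + y) * Real.sqrt (μp ^ 2 + 2 * q)))
        + 2 * (1 + β) / D β μp μm q *
            Real.exp (μp * (y - x) - (x + y) * Real.sqrt (μp ^ 2 + 2 * q)) := by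
  have hw : 0 < x + y := by linarith
  obtain ⟨i1, v1⟩ := laplace_phi hq (y - x) μp
  obtain ⟨i2, v2⟩ := laplace_phi hq (x + y) μp
  obtain ⟨i3, v3⟩ := laplace_convolution_h (μp := μp) (μm := μm) hβ hq hw
  have hs : √(μp ^ 2 + 2 * q) = √(2 * q + μp ^ 2) := by rw [add_comm]
  have hsplit : ∀ t : ℝ, Real.exp (-q * t) *
        (phi t (y - x) μp - Real.exp (-(2 * μp * x)) * phi t (x + y) μp
          + 2 * (1 + β) * Real.exp (2 * μp * y) *
            ∫ b in Ioi (0 : ℝ), ∫ τ in (0 : ℝ)..t,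
              h (t - τ) ((1 + β) * b + x + y) μp * h τ ((1 - β) * b) (-μm))
      = Real.exp (-q * t) * phi t (y - x) μp
        - Real.exp (-(2 * μp * x)) * (Real.exp (-q * t) * phi t (x + y) μp)
        + 2 * (1 + β) * Real.exp (2 * μp * y) * (Real.exp (-q * t) *
            ∫ b in Ioi (0 : ℝ), ∫ τ in (0 : ℝ)..t,
              h (t - τ) ((1 + β) * b + (x + y)) μp * h τ ((1 - β) * b) (-μm)) := fun t => by
    simp only [add_assoc]
    ring
  simp only [hsplit]
  have i12 := i1.sub (i2.const_mul (Real.exp (-(2 * μp * x))))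
  simp only [Pi.sub_def] at i12
  rw [integral_add i12 (i3.const_mul _), integral_sub i1 (i2.const_mul _), integral_const_mul, integral_const_mul, v1, v2, v3, hs,
    abs_of_pos hw]
  set s := √(2 * q + μp ^ 2)
  have e1 : Real.exp (μp * (y - x) - |y - x| * s)
      = Real.exp (μp * (y - x)) * Real.exp (-|y - x| * s) := by
    rw [← Real.exp_add]; congr 1; ring
  have e2 : Real.exp (-(2 * μp * x)) * Real.exp (μp * (x + y) - (x + y) * s)
      = Real.exp (μp * (y - x)) * Real.exp (-(x + y) * s) := by
    rw [← Real.exp_add, ← Real.exp_add]; congr 1; ring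
  have e3 : Real.exp (2 * μp * y) * Real.exp (-((x + y) * (μp + s)))
      = Real.exp (μp * (y - x) - (x + y) * s) := by
    rw [← Real.exp_add]; congr 1; ring
  rw [← e3, e1, mul_div_assoc', e2]
  ring
end

section
/- Let β ∈ (−1, 1), μ₋ > 0, μ₊ < 0, x ≥ 0 and y > 0. Then the one-sided limit as q → 0⁺ of [ (q e^{μ₊ (y − x)}/√(μ₊² + 2q)) · ( e^{−|y − x| √(μ₊² + 2q)} − e^{−(x + y) √(μ₊² + 2q)} ) + (2(1+β) q / D(q)) · e^{μ₊ (y − x) − (x + y) √(μ₊² + 2q)} ] equals −2(1+β) μ₊ μ₋ · e^{2 μ₊ y} / ( (1+β) μ₋ − (1−β) μ₊ ). -/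
open MeasureTheory Real Set Filter

/-- Rationalised form of the increment of `q ↦ √(2q + m²)` from its value `m` at `0`. -/
theorem neg_add_sqrt_eq_mul_div {m q : ℝ} (hm : 0 < m) (hq : 0 ≤ q) :
    -m + √(2 * q + m ^ 2) = q * (2 / (√(2 * q + m ^ 2) + m)) := by
  have hs : √(2 * q + m ^ 2) ^ 2 = 2 * q + m ^ 2 := Real.sq_sqrt (by positivity)
  have hne : √(2 * q + m ^ 2) + m ≠ 0 := by positivity
  field_simp
  linear_combination hs

theorem D_eq_mul {β μp μm q : ℝ} (hμm : 0 < μm) (hμp : μp < 0) (hq : 0 ≤ q) :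
    D β μp μm q = q * ((1 + β) * (2 / (√(2 * q + μp ^ 2) - μp)) +
      (1 - β) * (2 / (√(2 * q + μm ^ 2) + μm))) := by
  have hp := neg_add_sqrt_eq_mul_div (neg_pos.2 hμp) hq
  rw [neg_neg, neg_sq, ← sub_eq_add_neg] at hp
  rw [D, hp, neg_add_sqrt_eq_mul_div hμm hq]
  ring

/-- Long-time limit of the transition density for `μ₋ > 0`, `μ₊ < 0`, `x ≥ 0`, `y > 0`,
computed as the limit `q → 0⁺` of `q` times the potential density. -/
theorem stationary_density_pos (β μp μm x y : ℝ)
    (hβ : β ∈ Ioo (-1 : ℝ) 1) (hμm : 0 < μm) (hμp : μp < 0) (hx : 0 ≤ x) (hy : 0 < y) :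
    Tendsto (fun q : ℝ =>
        q * Real.exp (μp * (y - x)) / Real.sqrt (μp ^ 2 + 2 * q) *
            (Real.exp (-|y - x| * Real.sqrt (μp ^ 2 + 2 * q))
              - Real.exp (-(x + y) * Real.sqrt (μp ^ 2 + 2 * q)))
          + 2 * (1 + β) * q / D β μp μm q *
              Real.exp (μp * (y - x) - (x + y) * Real.sqrt (μp ^ 2 + 2 * q)))
      (nhdsWithin 0 (Ioi 0))
      (nhds (-2 * (1 + β) * μp * μm * Real.exp (2 * μp * y) /
        ((1 + β) * μm - (1 - β) * μp))) := by
  obtain ⟨hβ₁, hβ₂⟩ := hβ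
  have hp : √(μp ^ 2) = -μp := by rw [Real.sqrt_sq_eq_abs, abs_of_neg hμp]
  have hm : √(μm ^ 2) = μm := Real.sqrt_sq hμm.le
  have hden : (1 + β) * μm - (1 - β) * μp ≠ 0 := by
    have h₁ : 0 < (1 + β) * μm := mul_pos (by linarith) hμm
    have h₂ : 0 < (1 - β) * -μp := mul_pos (by linarith) (by linarith)
    linarith
  have hslope : (1 + β) * (2 / (-μp - μp)) + (1 - β) * (2 / (μm + μm)) =
      ((1 + β) * μm - (1 - β) * μp) / (-μp * μm) := by
    have h₁ : -μp - μp = 2 * -μp := by ring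
    have h₂ : μp ≠ 0 := hμp.ne
    rw [h₁]
    field_simp
    ring
  let R : ℝ → ℝ := fun q => √(μp ^ 2 + 2 * q)
  let S : ℝ → ℝ := fun q => (1 + β) * (2 / (√(2 * q + μp ^ 2) - μp)) +
    (1 - β) * (2 / (√(2 * q + μm ^ 2) + μm))
  have hS₀ : S 0 = ((1 + β) * μm - (1 - β) * μp) / (-μp * μm) := by
    simp only [S, mul_zero, zero_add, hp, hm, hslope]
  have hR₀ : R 0 = -μp := by simp only [R, mul_zero, add_zero, hp]
  have hRc : ContinuousAt R 0 := by fun_prop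
  have hSc : ContinuousAt S 0 := by
    refine .add (.mul continuousAt_const (.div continuousAt_const (by fun_prop) ?_))
      (.mul continuousAt_const (.div continuousAt_const (by fun_prop) ?_))
    · simp only [mul_zero, zero_add, hp]; linarith
    · simp only [mul_zero, zero_add, hm]; linarith
  have hS_ne : S 0 ≠ 0 := by
    rw [hS₀]
    exact div_ne_zero hden (mul_ne_zero (neg_ne_zero.2 hμp.ne) hμm.ne')
  have hR_ne : R 0 ≠ 0 := by rw [hR₀]; exact neg_ne_zero.2 hμp.ne
  let G : ℝ → ℝ := fun q => q * Real.exp (μp * (y - x)) / R q *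
      (Real.exp (-|y - x| * R q) - Real.exp (-(x + y) * R q)) +
    2 * (1 + β) / S q * Real.exp (μp * (y - x) - (x + y) * R q)
  have hGc : ContinuousAt G 0 := by
    refine .add (.mul (.div (by fun_prop) hRc hR_ne) (by fun_prop))
      (.mul (.div continuousAt_const hSc hS_ne) (by fun_prop))
  have hG₀ : G 0 = -2 * (1 + β) * μp * μm * Real.exp (2 * μp * y) /
      ((1 + β) * μm - (1 - β) * μp) := by
    have he : μp * (y - x) - (x + y) * -μp = 2 * μp * y := by ring
    simp only [G, hR₀, hS₀, he, zero_mul, zero_div, zero_add]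
    rw [div_div_eq_mul_div]
    ring
  rw [← hG₀]
  refine (hGc.tendsto.mono_left nhdsWithin_le_nhds).congr' ?_
  filter_upwards [self_mem_nhdsWithin] with q hq
  have hq : 0 < q := hq
  rw [D_eq_mul hμm hμp hq.le, mul_comm (2 * (1 + β)) q, mul_div_mul_left _ _ hq.ne']
end

section
/- Let β ∈ (−1, 1), μ₋ > 0, μ₊ < 0, x ≤ 0 and y < 0. Then the one-sided limit as q → 0⁺ of [ (q e^{μ₋ (y − x)}/√(μ₋² + 2q)) · ( e^{−|y − x| √(μ₋² + 2q)} − e^{(x + y) √(μ₋² + 2q)} ) + (2(1−β) q / D(q)) · e^{μ₋ (y − x) + (x + y) √(μ₋² + 2q)} ] equals −2(1−β) μ₊ μ₋ · e^{2 μ₋ y} / ( (1+β) μ₋ − (1−β) μ₊ ). -/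
open MeasureTheory Real Set Filter

/-- Rationalized form of `√(2q + a²) - a` for `a > 0`. -/
lemma neg_add_sqrt_eq_div {a q : ℝ} (ha : 0 < a) (hq : 0 < q) :
    -a + Real.sqrt (2 * q + a ^ 2) = q * (2 / (Real.sqrt (2 * q + a ^ 2) + a)) := by
  have hs : Real.sqrt (2 * q + a ^ 2) ^ 2 = 2 * q + a ^ 2 := Real.sq_sqrt (by positivity)
  have hpos : 0 < Real.sqrt (2 * q + a ^ 2) + a := by positivity
  field_simp
  linear_combination hs

lemma tendsto_sqrt_two_mul_add_sq {a : ℝ} (ha : 0 < a) :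
    Tendsto (fun q : ℝ => Real.sqrt (2 * q + a ^ 2)) (nhdsWithin 0 (Ioi 0)) (nhds a) := by
  have hc : Continuous fun q : ℝ => Real.sqrt (2 * q + a ^ 2) := by fun_prop
  have h := hc.tendsto 0
  rw [mul_zero, zero_add, Real.sqrt_sq ha.le] at h
  exact h.mono_left nhdsWithin_le_nhds

lemma tendsto_D_div {β μp μm : ℝ} (hμm : 0 < μm) (hμp : μp < 0) :
    Tendsto (fun q : ℝ => D β μp μm q / q) (nhdsWithin 0 (Ioi 0))
      (nhds ((1 + β) * (2 / (-μp + -μp)) + (1 - β) * (2 / (μm + μm)))) := by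
  have hp : 0 < -μp := neg_pos.mpr hμp
  have key : ∀ {a : ℝ}, 0 < a →
      Tendsto (fun q : ℝ => 2 / (Real.sqrt (2 * q + a ^ 2) + a)) (nhdsWithin 0 (Ioi 0))
        (nhds (2 / (a + a))) := fun ha =>
    tendsto_const_nhds.div ((tendsto_sqrt_two_mul_add_sq ha).add_const _) (by positivity)
  refine (((key hp).const_mul (1 + β)).add ((key hμm).const_mul (1 - β))).congr' ?_
  filter_upwards [self_mem_nhdsWithin] with q (hq : 0 < q)
  have h₁ := neg_add_sqrt_eq_div hp hq
  have h₂ := neg_add_sqrt_eq_div hμm hq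
  rw [neg_neg, neg_sq] at h₁
  rw [D, h₁, h₂, neg_sq, eq_div_iff hq.ne']
  ring

/-- Long-time limit of the transition density for `μ₋ > 0`, `μ₊ < 0`, `x ≤ 0`, `y < 0`,
computed as the limit `q → 0⁺` of `q` times the potential density. -/
theorem stationary_density_neg (β μp μm x y : ℝ)
    (hβ : β ∈ Ioo (-1 : ℝ) 1) (hμm : 0 < μm) (hμp : μp < 0) (hx : x ≤ 0) (hy : y < 0) :
    Tendsto (fun q : ℝ =>
        q * Real.exp (μm * (y - x)) / Real.sqrt (μm ^ 2 + 2 * q) *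
            (Real.exp (-|y - x| * Real.sqrt (μm ^ 2 + 2 * q))
              - Real.exp ((x + y) * Real.sqrt (μm ^ 2 + 2 * q)))
          + 2 * (1 - β) * q / D β μp μm q *
              Real.exp (μm * (y - x) + (x + y) * Real.sqrt (μm ^ 2 + 2 * q)))
      (nhdsWithin 0 (Ioi 0))
      (nhds (-2 * (1 - β) * μp * μm * Real.exp (2 * μm * y) /
        ((1 + β) * μm - (1 - β) * μp))) := by
  have hp : 0 < -μp := neg_pos.mpr hμp
  have hβ₁ : 0 < 1 + β := by linarith [hβ.1]
  have hβ₂ : 0 < 1 - β := by linarith [hβ.2]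
  have hs : Tendsto (fun q : ℝ => Real.sqrt (μm ^ 2 + 2 * q)) (nhdsWithin 0 (Ioi 0))
      (nhds μm) := by
    simpa only [add_comm] using tendsto_sqrt_two_mul_add_sq hμm
  have hq : Tendsto (fun q : ℝ => q) (nhdsWithin 0 (Ioi 0)) (nhds 0) :=
    tendsto_id.mono_left nhdsWithin_le_nhds
  have hfirst := ((hq.mul_const (Real.exp (μm * (y - x)))).div hs hμm.ne').mul
    ((hs.const_mul (-|y - x|)).rexp.sub (hs.const_mul (x + y)).rexp)
  have hL : 0 < (1 + β) * (2 / (-μp + -μp)) + (1 - β) * (2 / (μm + μm)) := by positivity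
  have hratio : Tendsto (fun q : ℝ => 2 * (1 - β) * q / D β μp μm q) (nhdsWithin 0 (Ioi 0))
      (nhds (2 * (1 - β) / ((1 + β) * (2 / (-μp + -μp)) + (1 - β) * (2 / (μm + μm))))) := by
    refine (tendsto_const_nhds.div (tendsto_D_div hμm hμp) hL.ne').congr fun q => ?_
    exact div_div_eq_mul_div _ _ _
  have hexp : μm * (y - x) + (x + y) * μm = 2 * μm * y := by ring
  have hL_eq : (1 + β) * (2 / (-μp + -μp)) + (1 - β) * (2 / (μm + μm)) =
      ((1 + β) * μm - (1 - β) * μp) / (-μp * μm) := by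
    have := hμp.ne
    rw [← two_mul, ← two_mul]
    field_simp
    ring
  have hlim := hfirst.add (hratio.mul ((hs.const_mul (x + y)).const_add (μm * (y - x))).rexp)
  rw [zero_mul, zero_div, zero_mul, zero_add, hexp, hL_eq, div_div_eq_mul_div] at hlim
  simp only [Pi.div_apply] at hlim
  convert hlim using 2
  ring
end

section
/- Let β ∈ (−1, 1), μ₋ > 0, μ₊ < 0, and x < 0 < z. Define ψ(q) := e^{ρ₂⁻(q) x} / ( (1 − c₂(q)) e^{ρ₂⁺(q) z} + c₂(q) e^{ρ₁⁺(q) z} ) for q > 0. Then the one-sided limit as q → 0⁺ of (1 − ψ(q))/q equals [ 2(1+β)(μ₋ μ₊ z − μ₊² x) + ( (1+β) μ₋ − (1−β) μ₊ ) ( e^{−2 μ₊ z} − 1 ) ] / ( 2 μ₋ μ₊² (1+β) ). -/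
open MeasureTheory Real Set Filter

/-- `ρ₁⁺(q) = −μ₊ − √(μ₊² + 2q)`. -/
noncomputable def ρ1p (μp q : ℝ) : ℝ := -μp - Real.sqrt (μp ^ 2 + 2 * q)

/-- `ρ₂⁺(q) = −μ₊ + √(μ₊² + 2q)`. -/
noncomputable def ρ2p (μp q : ℝ) : ℝ := -μp + Real.sqrt (μp ^ 2 + 2 * q)

/-- `ρ₂⁻(q) = −μ₋ + √(μ₋² + 2q)`. -/
noncomputable def ρ2m (μm q : ℝ) : ℝ := -μm + Real.sqrt (μm ^ 2 + 2 * q)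

/-- `c₂(q) = ((1+β) ρ₂⁺(q) − (1−β) ρ₂⁻(q)) / ((1+β)(ρ₂⁺(q) − ρ₁⁺(q)))`. -/
noncomputable def c2 (β μp μm q : ℝ) : ℝ :=
  ((1 + β) * ρ2p μp q - (1 - β) * ρ2m μm q) / ((1 + β) * (ρ2p μp q - ρ1p μp q))

/-- `ψ(q)`, the Laplace transform of the first passage time from `x < 0` to `z > 0`. -/
noncomputable def ψ (β μp μm x z q : ℝ) : ℝ :=
  Real.exp (ρ2m μm q * x) /
    ((1 - c2 β μp μm q) * Real.exp (ρ2p μp q * z)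
      + c2 β μp μm q * Real.exp (ρ1p μp q * z))

lemma hasDerivAt_sqrt_sq_add_two_mul {μ : ℝ} (hμ : μ ≠ 0) :
    HasDerivAt (fun q : ℝ => √(μ ^ 2 + 2 * q)) (1 / |μ|) 0 := by
  have h : HasDerivAt (fun q : ℝ => μ ^ 2 + 2 * q) 2 0 := by
    simpa using ((hasDerivAt_id (0 : ℝ)).const_mul 2).const_add (μ ^ 2)
  refine HasDerivAt.congr_deriv (h.sqrt (by simpa using hμ)) ?_
  have : |μ| ≠ 0 := abs_ne_zero.mpr hμ
  simp only [mul_zero, add_zero, sqrt_sq_eq_abs]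
  field_simp

lemma ρ1p_zero {μ : ℝ} (hμ : μ < 0) : ρ1p μ 0 = 0 := by
  simp [ρ1p, sqrt_sq_eq_abs, abs_of_neg hμ]

lemma ρ2p_zero {μ : ℝ} (hμ : μ < 0) : ρ2p μ 0 = -(2 * μ) := by
  simp only [ρ2p, mul_zero, add_zero, sqrt_sq_eq_abs, abs_of_neg hμ]
  ring

lemma ρ2m_zero {μ : ℝ} (hμ : 0 < μ) : ρ2m μ 0 = 0 := by
  simp [ρ2m, sqrt_sq_eq_abs, abs_of_pos hμ]

lemma hasDerivAt_ρ1p_zero {μ : ℝ} (hμ : μ < 0) : HasDerivAt (ρ1p μ) (1 / μ) 0 := by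
  refine HasDerivAt.congr_deriv ((hasDerivAt_sqrt_sq_add_two_mul hμ.ne).const_sub (-μ)) ?_
  rw [abs_of_neg hμ, one_div_neg_eq_neg_one_div, neg_neg]

lemma hasDerivAt_ρ2p_zero {μ : ℝ} (hμ : μ < 0) : HasDerivAt (ρ2p μ) (-(1 / μ)) 0 := by
  refine HasDerivAt.congr_deriv ((hasDerivAt_sqrt_sq_add_two_mul hμ.ne).const_add (-μ)) ?_
  rw [abs_of_neg hμ, one_div_neg_eq_neg_one_div]

lemma hasDerivAt_ρ2m_zero {μ : ℝ} (hμ : 0 < μ) : HasDerivAt (ρ2m μ) (1 / μ) 0 := by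
  refine HasDerivAt.congr_deriv ((hasDerivAt_sqrt_sq_add_two_mul hμ.ne').const_add (-μ)) ?_
  rw [abs_of_pos hμ]

lemma c2_zero {β μp μm : ℝ} (hβ : 1 + β ≠ 0) (hμm : 0 < μm) (hμp : μp < 0) :
    c2 β μp μm 0 = 1 := by
  have := hμp.ne
  rw [c2, ρ1p_zero hμp, ρ2p_zero hμp, ρ2m_zero hμm]
  field_simp
  ring

lemma hasDerivAt_c2_zero {β μp μm : ℝ} (hβ : 1 + β ≠ 0) (hμm : 0 < μm) (hμp : μp < 0) :
    HasDerivAt (c2 β μp μm)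
      (-(((1 + β) * μm - (1 - β) * μp) / (2 * μm * μp ^ 2 * (1 + β)))) 0 := by
  have hp := hμp.ne
  have hm := hμm.ne'
  have h2p := hasDerivAt_ρ2p_zero hμp
  have hden : (1 + β) * (ρ2p μp 0 - ρ1p μp 0) ≠ 0 := by
    rw [ρ2p_zero hμp, ρ1p_zero hμp]
    simp [hβ, hp]
  refine HasDerivAt.congr_deriv
    (((h2p.const_mul (1 + β)).sub ((hasDerivAt_ρ2m_zero hμm).const_mul (1 - β))).div
      ((h2p.sub (hasDerivAt_ρ1p_zero hμp)).const_mul (1 + β)) hden) ?_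
  simp only [Pi.sub_apply, ρ2p_zero hμp, ρ1p_zero hμp, ρ2m_zero hμm]
  field_simp
  ring

lemma ψ_zero {β μp μm : ℝ} (x z : ℝ) (hβ : 1 + β ≠ 0) (hμm : 0 < μm) (hμp : μp < 0) :
    ψ β μp μm x z 0 = 1 := by
  simp [ψ, c2_zero hβ hμm hμp, ρ1p_zero hμp, ρ2m_zero hμm]

lemma hasDerivAt_ψ_zero {β μp μm : ℝ} (x z : ℝ) (hβ : 1 + β ≠ 0) (hμm : 0 < μm)
    (hμp : μp < 0) :
    HasDerivAt (ψ β μp μm x z)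
      (-((2 * (1 + β) * (μm * μp * z - μp ^ 2 * x)
          + ((1 + β) * μm - (1 - β) * μp) * (Real.exp (-(2 * μp * z)) - 1)) /
        (2 * μm * μp ^ 2 * (1 + β)))) 0 := by
  have hp := hμp.ne
  have hm := hμm.ne'
  have hc := hasDerivAt_c2_zero hβ hμm hμp
  have hden : (1 - c2 β μp μm 0) * Real.exp (ρ2p μp 0 * z)
      + c2 β μp μm 0 * Real.exp (ρ1p μp 0 * z) ≠ 0 := by
    simp [c2_zero hβ hμm hμp, ρ1p_zero hμp]
  refine HasDerivAt.congr_deriv (((hasDerivAt_ρ2m_zero hμm).mul_const x).exp.div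
      (((hc.const_sub 1).mul ((hasDerivAt_ρ2p_zero hμp).mul_const z).exp).add
        (hc.mul ((hasDerivAt_ρ1p_zero hμp).mul_const z).exp)) hden) ?_
  simp only [c2_zero hβ hμm hμp, ρ1p_zero hμp, ρ2m_zero hμm,
    ρ2p_zero hμp, zero_mul, Real.exp_zero, neg_mul]
  field_simp
  ring

/-- Expected first passage time from `x < 0` to `z > 0` when `μ₋ > 0` and `μ₊ < 0`:
the limit as `q → 0⁺` of `(1 − ψ(q))/q`. -/
theorem expected_passage_time (β μp μm x z : ℝ)
    (hβ : β ∈ Ioo (-1 : ℝ) 1) (hμm : 0 < μm) (hμp : μp < 0) (hx : x < 0) (hz : 0 < z) :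
    Tendsto (fun q : ℝ => (1 - ψ β μp μm x z q) / q)
      (nhdsWithin 0 (Ioi 0))
      (nhds ((2 * (1 + β) * (μm * μp * z - μp ^ 2 * x)
          + ((1 + β) * μm - (1 - β) * μp) * (Real.exp (-(2 * μp * z)) - 1)) /
        (2 * μm * μp ^ 2 * (1 + β)))) := by
  have hb : 1 + β ≠ 0 := by linarith [hβ.1]
  have h := ((hasDerivAt_ψ_zero x z hb hμm hμp).hasDerivWithinAt (s := Ioi 0)).neg
  rw [hasDerivWithinAt_iff_tendsto_slope' (by simp), neg_neg] at h
  refine h.congr fun q => ?_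
  rw [slope_def_field, Pi.neg_apply, Pi.neg_apply, ψ_zero x z hb hμm hμp]
  ring
end

section
/- Let β ∈ (−1, 1), μ ∈ ℝ and t > 0. Then 4β ∫₀^∞ ∫₀^t h(t − τ; (1+β) b, μ) · h(τ; (1−β) b, −μ) dτ db = (√2 β / √(π t)) · e^{−μ² t / 2} · [ 1 − (β μ / 2) √(2π t) · e^{β² μ² t / 2} · erfc( β μ √(t/2) ) ]. -/
open MeasureTheory Real Set Filter

/-- The complementary error function `erfc(z) = (2/√π) ∫_z^∞ e^{−u²} du`. -/
noncomputable def erfc (z : ℝ) : ℝ :=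
  2 / Real.sqrt Real.pi * ∫ u in Ioi z, Real.exp (-u ^ 2)

open Topology

lemma hasDerivAt_integral_exp_neg_sq (z : ℝ) :
    HasDerivAt (fun w : ℝ => ∫ u in (0 : ℝ)..w, exp (-u ^ 2)) (exp (-z ^ 2)) z :=
  ((by fun_prop : Continuous fun u : ℝ => exp (-u ^ 2)).integral_hasStrictDerivAt 0 z).hasDerivAt

lemma tendsto_integral_exp_neg_sq_atTop :
    Tendsto (fun w : ℝ => ∫ u in (0 : ℝ)..w, exp (-u ^ 2)) atTop (𝓝 (√π / 2)) := by
  have hi : Integrable fun u : ℝ => exp (-u ^ 2) := by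
    simpa using integrable_exp_neg_mul_sq one_pos
  have := intervalIntegral_tendsto_integral_Ioi 0 hi.integrableOn tendsto_id
  have h2 := integral_gaussian_Ioi 1
  simp only [neg_mul, one_mul, div_one] at h2
  rwa [h2] at this

lemma tendsto_integral_exp_neg_sq_atBot :
    Tendsto (fun w : ℝ => ∫ u in (0 : ℝ)..w, exp (-u ^ 2)) atBot (𝓝 (-(√π / 2))) := by
  have h := (tendsto_integral_exp_neg_sq_atTop.comp tendsto_neg_atBot_atTop).neg
  refine h.congr fun w => ?_
  have := intervalIntegral.integral_comp_neg (a := 0) (b := w) fun u : ℝ => exp (-u ^ 2)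
  simp only [even_two, Even.neg_pow, neg_zero] at this
  simp only [Function.comp]
  rw [this, intervalIntegral.integral_symm, neg_neg]

lemma integral_sub_mul_exp_neg_sq_Ioi (d : ℝ) :
    ∫ u in Ioi d, (u - d) * exp (-u ^ 2) = exp (-d ^ 2) / 2 - d * ∫ u in Ioi d, exp (-u ^ 2) := by
  have hi : Integrable fun u : ℝ => exp (-u ^ 2) := by
    simpa using integrable_exp_neg_mul_sq one_pos
  have hi' : Integrable fun u : ℝ => u * exp (-u ^ 2) := by
    simpa using integrable_mul_exp_neg_mul_sq one_pos
  have key : ∫ u in Ioi d, u * exp (-u ^ 2) = 0 - -(exp (-d ^ 2) / 2) := by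
    refine integral_Ioi_of_hasDerivAt_of_tendsto' (f := fun u => -(exp (-u ^ 2) / 2))
      (fun u _ => ?_) hi'.integrableOn ?_
    · convert! ((((hasDerivAt_id u).fun_pow 2).fun_neg.exp).div_const 2).fun_neg using 1
      simp; ring
    · have : Tendsto (fun u : ℝ => -u ^ 2) atTop atBot :=
        tendsto_neg_atTop_atBot.comp (tendsto_pow_atTop two_ne_zero)
      simpa using ((tendsto_exp_atBot.comp this).div_const 2).neg
  simp only [sub_mul]
  rw [integral_sub hi'.integrableOn (hi.const_mul d).integrableOn, integral_const_mul, key]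
  ring

lemma sqrt_two_pi_mul_cube {s : ℝ} (hs : 0 ≤ s) : √(2 * π * s ^ 3) = √2 * √π * √s ^ 3 := by
  rw [sqrt_mul (by positivity), sqrt_mul (by norm_num), ← sqrt_sq (by positivity : 0 ≤ √s ^ 3)]
  congr 2
  rw [← pow_mul, mul_comm 3 2, pow_mul, sq_sqrt hs]

lemma hasDerivAt_affine_div_sqrt {x y t τ : ℝ} (h0 : 0 < τ) (ht : τ < t) :
    HasDerivAt (fun s => (y * (t - s) - x * s) / √(2 * t * (s * (t - s))))
      (-(y * (t - τ) + x * τ) * t ^ 2 / √(2 * t * (τ * (t - τ))) ^ 3) τ := by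
  have hp : 0 < 2 * t * (τ * (t - τ)) := by
    have := sub_pos.2 ht; have := h0.trans ht; positivity
  have hR := sqrt_pos.2 hp
  have hR2 := sq_sqrt hp.le
  have h1 : HasDerivAt (fun s => y * (t - s) - x * s) (-(x + y)) τ := by
    convert! (((hasDerivAt_id τ).const_sub t).const_mul y).sub ((hasDerivAt_id τ).const_mul x)
      using 1
    ring
  have h2 : HasDerivAt (fun s => 2 * t * (s * (t - s))) (2 * t * (t - 2 * τ)) τ := by
    convert! ((hasDerivAt_id' τ).mul ((hasDerivAt_id' τ).const_sub t)).const_mul (2 * t) using 1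
    ring
  convert! h1.div (h2.sqrt hp.ne') hR.ne' using 1
  generalize √(2 * t * (τ * (t - τ))) = R at hR hR2 ⊢
  field_simp
  rw [hR2]
  ring

lemma tendsto_div_sqrt_atTop {f g : ℝ → ℝ} {l : Filter ℝ} {c : ℝ} (hc : 0 < c)
    (hf : Tendsto f l (𝓝 c)) (hg : Tendsto g l (𝓝 0)) (hpos : ∀ᶠ s in l, 0 < g s) :
    Tendsto (fun s => f s / √(g s)) l atTop := by
  simp only [div_eq_mul_inv]
  refine hf.pos_mul_atTop hc (tendsto_inv_nhdsGT_zero.comp (tendsto_nhdsWithin_iff.2 ⟨?_, ?_⟩))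
  · simpa using hg.sqrt
  · filter_upwards [hpos] with s hs using sqrt_pos.2 hs

lemma integral_eq_sub_of_hasDerivAt_of_tendsto_of_nonneg {f f' : ℝ → ℝ} {a b fa fb : ℝ}
    (hab : a < b) (hderiv : ∀ s ∈ Ioo a b, HasDerivAt f (f' s) s)
    (hpos : ∀ s ∈ Ioo a b, 0 ≤ f' s) (ha : Tendsto f (𝓝[>] a) (𝓝 fa))
    (hb : Tendsto f (𝓝[<] b) (𝓝 fb)) : ∫ s in a..b, f' s = fb - fa := by
  have hcont : ContinuousOn f (Ioo a b) := fun s hs => (hderiv s hs).continuousAt.continuousWithinAt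
  have hc := continuousOn_Icc_extendFrom_Ioo hcont ha hb
  refine intervalIntegral.integral_eq_sub_of_hasDerivAt_of_tendsto hab hderiv ?_ ha hb
  refine intervalIntegral.intervalIntegrable_deriv_of_nonneg (g := extendFrom (Ioo a b) f) ?_ ?_ ?_
  · rwa [uIcc_of_le hab.le]
  · rw [min_eq_left hab.le, max_eq_right hab.le]
    intro s hs
    refine (hderiv s hs).congr_of_eventuallyEq ?_
    filter_upwards [Ioo_mem_nhds hs.1 hs.2] with r hr
    exact extendFrom_extends hcont r hr
  · rwa [min_eq_left hab.le, max_eq_right hab.le]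

lemma integral_exp_div_sqrt_cube {x y t : ℝ} (hx : 0 < x) (hy : 0 < y) (ht : 0 < t) :
    ∫ τ in (0 : ℝ)..t, 2 * x * y * t ^ 3 / √(2 * t * (τ * (t - τ))) ^ 3 *
        exp (-x ^ 2 / (2 * (t - τ)) - y ^ 2 / (2 * τ)) =
      √π * ((x + y) * exp (-(x + y) ^ 2 / (2 * t))) := by
  set G : ℝ → ℝ := fun w => ∫ u in (0 : ℝ)..w, exp (-u ^ 2) with hG
  set A : ℝ → ℝ → ℝ := fun z s => (y * (t - s) - z * s) / √(2 * t * (s * (t - s))) with hA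
  have hpos : ∀ s ∈ Ioo 0 t, 0 < 2 * t * (s * (t - s)) := fun s hs => by
    have := sub_pos.2 hs.2; have := hs.1; positivity
  have hexp : ∀ z, ∀ s ∈ Ioo 0 t, exp (-(z + y) ^ 2 / (2 * t)) * exp (-(A z s) ^ 2) =
      exp (-z ^ 2 / (2 * (t - s)) - y ^ 2 / (2 * s)) := fun z s hs => by
    have h1 := hs.1.ne'
    have h2 := (sub_pos.2 hs.2).ne'
    rw [← exp_add, hA, div_pow, sq_sqrt (hpos s hs).le]
    congr 1
    field_simp
    ring
  have hg : Continuous fun s : ℝ => 2 * t * (s * (t - s)) := by fun_prop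
  have hnum : ∀ z, Continuous fun s : ℝ => y * (t - s) - z * s := fun z => by fun_prop
  have h0 : ∀ z, Tendsto (A z) (𝓝[>] 0) atTop := fun z => by
    refine tendsto_div_sqrt_atTop (c := y * t) (by positivity) ?_ ?_ ?_
    · simpa using (hnum z).continuousWithinAt.tendsto (x := 0) (s := Ioi 0)
    · simpa using hg.continuousWithinAt.tendsto (x := 0) (s := Ioi 0)
    · filter_upwards [Ioo_mem_nhdsGT ht] with s hs using hpos s hs
  have hgt : Tendsto (fun s : ℝ => 2 * t * (s * (t - s))) (𝓝[<] t) (𝓝 0) := by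
    simpa using hg.continuousWithinAt.tendsto (x := t) (s := Iio t)
  have hevt : ∀ᶠ s in 𝓝[<] t, 0 < 2 * t * (s * (t - s)) := by
    filter_upwards [Ioo_mem_nhdsLT ht] with s hs using hpos s hs
  have ht1 : Tendsto (A (-x)) (𝓝[<] t) atTop := by
    refine tendsto_div_sqrt_atTop (c := x * t) (by positivity) ?_ hgt hevt
    simpa using (hnum (-x)).continuousWithinAt.tendsto (x := t) (s := Iio t)
  have ht2 : Tendsto (A x) (𝓝[<] t) atBot := by
    have : Tendsto (fun s => -A x s) (𝓝[<] t) atTop := by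
      simp only [hA, ← neg_div]
      refine tendsto_div_sqrt_atTop (c := x * t) (by positivity) ?_ hgt hevt
      simpa using (hnum x).fun_neg.continuousWithinAt.tendsto (x := t) (s := Iio t)
    simpa [Function.comp_def] using tendsto_neg_atTop_atBot.comp this
  have hGA : ∀ z, ∀ s ∈ Ioo 0 t, HasDerivAt (fun s => G (A z s))
      (exp (-(A z s) ^ 2) * (-(y * (t - s) + z * s) * t ^ 2 / √(2 * t * (s * (t - s))) ^ 3)) s :=
    fun z s hs => (hasDerivAt_integral_exp_neg_sq (A z s)).comp s
      (hasDerivAt_affine_div_sqrt hs.1 hs.2)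
  set p := (x + y) * exp (-(x + y) ^ 2 / (2 * t)) with hp
  set q := (x - y) * exp (-(-x + y) ^ 2 / (2 * t)) with hq
  have hT := tendsto_integral_exp_neg_sq_atTop
  have hB := tendsto_integral_exp_neg_sq_atBot
  refine (integral_eq_sub_of_hasDerivAt_of_tendsto_of_nonneg
    (f := fun s => -(p * G (A x s) + q * G (A (-x) s)))
    (fa := -(p * (√π / 2) + q * (√π / 2))) (fb := -(p * -(√π / 2) + q * (√π / 2))) ht
    (fun s hs => ?_) (fun s hs => ?_) ?_ ?_).trans ?_
  · refine (((hGA x s hs).const_mul p).add ((hGA (-x) s hs).const_mul q)).neg.congr_deriv ?_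
    have e1 := hexp x s hs
    have e2 := hexp (-x) s hs
    rw [neg_sq] at e2
    rw [hp, hq]
    generalize √(2 * t * (s * (t - s))) = R
    linear_combination (x + y) * (y * (t - s) + x * s) * t ^ 2 / R ^ 3 * e1 +
      (x - y) * (y * (t - s) - x * s) * t ^ 2 / R ^ 3 * e2
  · have := (hpos s hs).le
    positivity
  · exact (((hT.comp (h0 x)).const_mul p).add ((hT.comp (h0 (-x))).const_mul q)).neg
  · exact (((hB.comp ht2).const_mul p).add ((hT.comp ht1).const_mul q)).neg
  · ring

lemma integral_h_mul_h {x y t : ℝ} (μ : ℝ) (hx : 0 < x) (hy : 0 < y) (ht : 0 < t) :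
    ∫ τ in (0 : ℝ)..t, h (t - τ) x μ * h τ y (-μ) =
      exp (-μ * (x - y) - μ ^ 2 * t / 2) * h t (x + y) 0 := by
  have key : ∀ τ ∈ Ioo 0 t, h (t - τ) x μ * h τ y (-μ) =
      exp (-μ * (x - y) - μ ^ 2 * t / 2) / (√(2 * π * t ^ 3) * √π) *
        (2 * x * y * t ^ 3 / √(2 * t * (τ * (t - τ))) ^ 3 *
          exp (-x ^ 2 / (2 * (t - τ)) - y ^ 2 / (2 * τ))) := fun τ hτ => by
    have h1 : 0 < τ := hτ.1
    have h2 : 0 < t - τ := sub_pos.2 hτ.2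
    have e : exp (-(x + μ * (t - τ)) ^ 2 / (2 * (t - τ))) * exp (-(y + -μ * τ) ^ 2 / (2 * τ)) =
        exp (-μ * (x - y) - μ ^ 2 * t / 2) *
          exp (-x ^ 2 / (2 * (t - τ)) - y ^ 2 / (2 * τ)) := by
      rw [← exp_add, ← exp_add]
      congr 1
      field_simp
      ring
    have r : √(2 * t * (τ * (t - τ))) = √2 * √t * (√τ * √(t - τ)) := by
      rw [sqrt_mul (by positivity), sqrt_mul (by positivity), sqrt_mul h1.le]
    have pre : |x| / √(2 * π * (t - τ) ^ 3) * (|y| / √(2 * π * τ ^ 3)) =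
        2 * x * y * t ^ 3 / √(2 * t * (τ * (t - τ))) ^ 3 / (√(2 * π * t ^ 3) * √π) := by
      rw [sqrt_two_pi_mul_cube h1.le, sqrt_two_pi_mul_cube h2.le, sqrt_two_pi_mul_cube ht.le, r,
        abs_of_pos hx, abs_of_pos hy]
      have a1 := sqrt_pos.2 h1
      have a2 := sqrt_pos.2 h2
      have a3 := sqrt_pos.2 ht
      have a4 : 0 < √π := sqrt_pos.2 pi_pos
      have a5 : 0 < √(2 : ℝ) := by positivity
      have a6 : √t ^ 6 = t ^ 3 := by rw [show 6 = 2 * 3 from rfl, pow_mul, sq_sqrt ht.le]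
      have a7 : √(2 : ℝ) ^ 2 = 2 := sq_sqrt (by norm_num)
      rw [← a6]
      field_simp
      linear_combination a7
    calc h (t - τ) x μ * h τ y (-μ)
        = (|x| / √(2 * π * (t - τ) ^ 3) * (|y| / √(2 * π * τ ^ 3))) *
          (exp (-(x + μ * (t - τ)) ^ 2 / (2 * (t - τ))) * exp (-(y + -μ * τ) ^ 2 / (2 * τ))) := by
          unfold h; ring
      _ = _ := by rw [e, pre]; ring
  rw [intervalIntegral.integral_of_le ht.le, integral_Ioc_eq_integral_Ioo,
    setIntegral_congr_fun measurableSet_Ioo key, ← integral_Ioc_eq_integral_Ioo,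
    ← intervalIntegral.integral_of_le ht.le, intervalIntegral.integral_const_mul,
    integral_exp_div_sqrt_cube hx hy ht, h, abs_of_pos (by positivity), zero_mul, add_zero]
  have : 0 < √π := sqrt_pos.2 pi_pos
  field_simp

lemma integral_comp_mul_add_Ioi (f : ℝ → ℝ) {k : ℝ} (d : ℝ) (hk : 0 < k) :
    ∫ b in Ioi (0 : ℝ), f (k * b + d) = k⁻¹ * ∫ u in Ioi d, f u := by
  rw [integral_comp_mul_left_Ioi (fun z => f (z + d)) 0 hk, smul_eq_mul, mul_zero,
    ← (measurePreserving_add_right volume d).setIntegral_preimage_emb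
      (measurableEmbedding_addRight d) f (Ioi d)]
  simp

lemma integral_mul_exp_Ioi (m : ℝ) {t : ℝ} (ht : 0 < t) :
    ∫ b in Ioi (0 : ℝ), b * exp (-(2 * b ^ 2 / t) - 2 * m * b) =
      t / 4 * (1 - m / 2 * √(2 * π * t) * exp (m ^ 2 * t / 2) * erfc (m * √(t / 2))) := by
  have hr : 0 < √(t / 2) := by positivity
  have hr2 : √(t / 2) ^ 2 = t / 2 := sq_sqrt (by positivity)
  have hrt : t = 2 * √(t / 2) ^ 2 := by rw [hr2]; ring
  have hpi : √(2 * π * t) = 2 * √π * √(t / 2) := by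
    rw [show 2 * π * t = 2 ^ 2 * (π * (t / 2)) by ring, sqrt_mul (by positivity),
      sqrt_sq (by norm_num), sqrt_mul pi_pos.le]
    ring
  set r := √(t / 2)
  have key : ∀ b, b * exp (-(2 * b ^ 2 / t) - 2 * m * b) = r * exp (m ^ 2 * t / 2) *
      ((r⁻¹ * b + m * r - m * r) * exp (-(r⁻¹ * b + m * r) ^ 2)) := fun b => by
    rw [show r * exp (m ^ 2 * t / 2) *
      ((r⁻¹ * b + m * r - m * r) * exp (-(r⁻¹ * b + m * r) ^ 2)) =
      (r * r⁻¹) * b * (exp (m ^ 2 * t / 2) * exp (-(r⁻¹ * b + m * r) ^ 2)) by ring, ← exp_add,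
      mul_inv_cancel₀ hr.ne', one_mul, hrt]
    congr 2
    field_simp
    ring
  have hπ : 0 < √π := sqrt_pos.2 pi_pos
  have he : exp (m ^ 2 * t / 2) * exp (-(r ^ 2 * m ^ 2)) = 1 := by
    rw [← exp_add, hr2, ← exp_zero]
    congr 1
    ring
  simp only [key]
  rw [integral_const_mul,
    integral_comp_mul_add_Ioi (fun u => (u - m * r) * exp (-u ^ 2)) (m * r) (inv_pos.2 hr),
    integral_sub_mul_exp_neg_sq_Ioi, hpi, erfc, inv_inv]
  generalize (∫ u in Ioi (m * r), exp (-u ^ 2)) = I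
  have h4 : t / 4 = r ^ 2 / 2 := by rw [hr2]; ring
  rw [h4]
  field_simp
  linear_combination he

/-- Size of the discontinuity at `y = 0` of the transition density of skew Brownian
motion with equal drifts `μ₊ = μ₋ = μ` started at `0`. -/
theorem jump_size_equal_drifts (β μ t : ℝ)
    (hβ : β ∈ Ioo (-1 : ℝ) 1) (ht : 0 < t) :
    4 * β * ∫ b in Ioi (0 : ℝ), ∫ τ in (0 : ℝ)..t,
        h (t - τ) ((1 + β) * b) μ * h τ ((1 - β) * b) (-μ)
      = Real.sqrt 2 * β / Real.sqrt (Real.pi * t) * Real.exp (-(μ ^ 2 * t) / 2) *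
          (1 - β * μ / 2 * Real.sqrt (2 * Real.pi * t) *
            Real.exp (β ^ 2 * μ ^ 2 * t / 2) * erfc (β * μ * Real.sqrt (t / 2))) := by
  have key : ∀ b ∈ Ioi (0 : ℝ), (∫ τ in (0 : ℝ)..t,
      h (t - τ) ((1 + β) * b) μ * h τ ((1 - β) * b) (-μ)) =
      2 / √(2 * π * t ^ 3) * exp (-(μ ^ 2 * t) / 2) *
        (b * exp (-(2 * b ^ 2 / t) - 2 * (β * μ) * b)) := fun b hb => by
    have hb : 0 < b := hb
    have h1 : 0 < 1 + β := by linarith [hβ.1]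
    have h2 : 0 < 1 - β := by linarith [hβ.2]
    rw [integral_h_mul_h μ (by positivity) (by positivity) ht,
      show (1 + β) * b + (1 - β) * b = 2 * b by ring, h, abs_of_pos (by positivity)]
    have e : exp (-μ * ((1 + β) * b - (1 - β) * b) - μ ^ 2 * t / 2) *
        exp (-(2 * b + 0 * t) ^ 2 / (2 * t)) =
        exp (-(μ ^ 2 * t) / 2) * exp (-(2 * b ^ 2 / t) - 2 * (β * μ) * b) := by
      rw [← exp_add, ← exp_add]
      congr 1
      field_simp
      ring
    linear_combination 2 * b / √(2 * π * t ^ 3) * e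
  rw [setIntegral_congr_fun measurableSet_Ioi key, integral_const_mul, integral_mul_exp_Ioi _ ht,
    sqrt_two_pi_mul_cube ht.le, sqrt_mul pi_pos.le, mul_pow β μ 2]
  generalize 1 - β * μ / 2 * √(2 * π * t) * exp (β ^ 2 * μ ^ 2 * t / 2) *
    erfc (β * μ * √(t / 2)) = E
  have a1 := sqrt_pos.2 ht
  have a2 : 0 < √π := sqrt_pos.2 pi_pos
  have a3 : √t ^ 2 = t := sq_sqrt ht.le
  have a4 : √(2 : ℝ) ^ 2 = 2 := sq_sqrt (by norm_num)
  field_simp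
  rw [a3, a4]
end
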